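/- Fix α > 0 and let Λ be the set of probability density functions supported on (−α/4, α/4) with finite differential entropy. Then sup_{p ∈ Λ} exp(2 h(W_1)) / exp(2 h(W_1 + W_2)) = 1/2, where for each p ∈ Λ, W_1 and W_2 denote independent random variables each with density p. -/

import Mathlib

open MeasureTheory ProbabilityTheory Real

/-- Differential entropy `-∫ f log f` of a probability density function `f` on `ℝ`. -/
noncomputable def entOfDensity (f : ℝ → ℝ) : ℝ :=
  -∫ x : ℝ, f x * Real.log (f x)

/-- The density of the sum `W₁ + W₂` of two independent random variables with common
density `f`: the convolution `(f ⋆ f) z = ∫ f x * f (z - x) dx`. -/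
noncomputable def selfConv (f : ℝ → ℝ) : ℝ → ℝ :=
  fun z => ∫ x : ℝ, f x * f (z - x)

/-- `Λ α`: the set of probability density functions supported on `(-α/4, α/4)`
having finite differential entropy. -/
def Lam (α : ℝ) : Set (ℝ → ℝ) :=
  {f | Measurable f ∧ (∀ x, 0 ≤ f x) ∧
    (∀ x ∉ Set.Ioo (-(α / 4)) (α / 4), f x = 0) ∧
    (∫ x : ℝ, f x) = 1 ∧ Integrable (fun x : ℝ => f x * Real.log (f x))}

/-- For `W₁`, `W₂` independent with common density `p`, the ratio
`exp (2 h(W₁)) / exp (2 h(W₁ + W₂))`; the sum `W₁ + W₂` has density `p ⋆ p`. -/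
noncomputable def entRatio (p : ℝ → ℝ) : ℝ :=
  Real.exp (2 * entOfDensity p) / Real.exp (2 * entOfDensity (selfConv p))

open Set Filter Topology
open scoped ENNReal NNReal

/-- The measure on `ℝ` with Lebesgue density `f`. -/
noncomputable def densMeasure (f : ℝ → ℝ) : Measure ℝ :=
  volume.withDensity fun x => ENNReal.ofReal (f x)

/-- A measurable nonnegative function on `ℝ` with total integral one. -/
structure IsDensity (f : ℝ → ℝ) : Prop where
  measurable : Measurable f
  nonneg : ∀ x, 0 ≤ f x
  integral_eq_one : ∫ x, f x = 1

namespace IsDensity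

variable {f : ℝ → ℝ}

lemma integrable (hf : IsDensity f) : Integrable f :=
  Integrable.of_integral_ne_zero (by simp [hf.integral_eq_one])

lemma lintegral_eq_one (hf : IsDensity f) : ∫⁻ x, ENNReal.ofReal (f x) = 1 := by
  rw [← ofReal_integral_eq_lintegral_ofReal hf.integrable (ae_of_all _ hf.nonneg),
    hf.integral_eq_one, ENNReal.ofReal_one]

lemma isProbabilityMeasure (hf : IsDensity f) : IsProbabilityMeasure (densMeasure f) :=
  ⟨by rw [densMeasure, withDensity_apply _ MeasurableSet.univ, Measure.restrict_univ,
    hf.lintegral_eq_one]⟩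

lemma absolutelyContinuous (f : ℝ → ℝ) : densMeasure f ≪ volume :=
  withDensity_absolutelyContinuous _ _

lemma integral_densMeasure (hf : IsDensity f) (φ : ℝ → ℝ) :
    ∫ x, φ x ∂densMeasure f = ∫ x, f x * φ x := by
  rw [densMeasure, integral_withDensity_eq_integral_toReal_smul
    hf.measurable.ennreal_ofReal (by simp)]
  simp [ENNReal.toReal_ofReal (hf.nonneg _)]

lemma integrable_densMeasure (hf : IsDensity f) {φ : ℝ → ℝ} :
    Integrable φ (densMeasure f) ↔ Integrable fun x => f x * φ x := by
  rw [densMeasure, integrable_withDensity_iff_integrable_smul'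
    hf.measurable.ennreal_ofReal (by simp)]
  simp [ENNReal.toReal_ofReal (hf.nonneg _)]

lemma ae_pos (hf : IsDensity f) : ∀ᵐ x ∂densMeasure f, 0 < f x := by
  rw [densMeasure, ae_withDensity_iff hf.measurable.ennreal_ofReal]
  refine ae_of_all _ fun x hx => ?_
  simpa using hx

lemma ae_hasDerivAt_cdf (hf : IsDensity f) :
    ∀ᵐ x, HasDerivAt (cdf (densMeasure f)) (f x) x := by
  have := hf.isProbabilityMeasure
  filter_upwards [LocallyIntegrable.ae_hasDerivAt_integral hf.integrable.locallyIntegrable]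
    with x hx
  have h : ∀ y, cdf (densMeasure f) y = (∫ t in (0 : ℝ)..y, f t) + ∫ t in Iic 0, f t := by
    intro y
    rw [← intervalIntegral.integral_Iic_sub_Iic hf.integrable.integrableOn
      hf.integrable.integrableOn, sub_add_cancel, cdf_eq_real, measureReal_def, densMeasure,
      withDensity_apply _ measurableSet_Iic, integral_eq_lintegral_of_nonneg_ae
      (ae_of_all _ hf.nonneg) hf.measurable.aestronglyMeasurable]
  rw [show ⇑(cdf (densMeasure f)) = _ from funext h]
  exact (hx 0).add_const _

end IsDensity

lemma continuous_cdf (ν : Measure ℝ) [IsProbabilityMeasure ν] [NullSingletonClass ν] :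
    Continuous (cdf ν) := by
  refine continuous_iff_continuousAt.2 fun x => ?_
  rw [(cdf ν).mono.continuousAt_iff_leftLim_eq_rightLim, StieltjesFunction.rightLim_eq]
  have h := (cdf ν).measure_singleton x
  rw [measure_cdf, measure_singleton] at h
  have := ENNReal.ofReal_eq_zero.1 h.symm
  exact le_antisymm ((cdf ν).mono.leftLim_le le_rfl) (by linarith)

lemma strictMono_cdf (μ : Measure ℝ) [IsProbabilityMeasure μ] [μ.IsOpenPosMeasure] :
    StrictMono (cdf μ) := by
  intro x y hxy
  have h : 0 < (cdf μ).measure (Ioc x y) := by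
    rw [measure_cdf]
    exact (Measure.measure_Ioo_pos μ |>.2 hxy).trans_le (measure_mono Ioo_subset_Ioc_self)
  rw [StieltjesFunction.measure_Ioc, ENNReal.ofReal_pos] at h
  linarith

/-- The monotone rearrangement transporting `μ` to `ν`. -/
lemma exists_strictMono_map_eq (μ ν : Measure ℝ) [IsProbabilityMeasure μ] [IsProbabilityMeasure ν]
    [NullSingletonClass μ] [NullSingletonClass ν] [μ.IsOpenPosMeasure] :
    ∃ T : ℝ → ℝ, StrictMono T ∧ (∀ x, cdf ν (T x) = cdf μ x) ∧ μ.map T = ν := by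
  have ivt : ∀ (ρ : Measure ℝ) [IsProbabilityMeasure ρ] [NullSingletonClass ρ] (c : ℝ),
      0 < c → c < 1 → ∃ t, cdf ρ t = c := by
    intro ρ _ _ c h0 h1
    obtain ⟨a, ha⟩ := ((tendsto_cdf_atBot ρ).eventually_lt_const h0).exists
    obtain ⟨b, hb⟩ := ((tendsto_cdf_atTop ρ).eventually_const_lt h1).exists
    exact mem_range_of_exists_le_of_exists_ge (continuous_cdf ρ) ⟨a, ha.le⟩ ⟨b, hb.le⟩
  have hΦ := strictMono_cdf μ
  have hpos : ∀ x, 0 < cdf μ x := fun x =>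
    (cdf_nonneg μ (x - 1)).trans_lt (hΦ (by linarith))
  have hlt : ∀ x, cdf μ x < 1 := fun x =>
    (hΦ (show x < x + 1 by linarith)).trans_le (cdf_le_one μ _)
  choose T hT using fun x => ivt ν (cdf μ x) (hpos x) (hlt x)
  have lt_of : ∀ {s t}, cdf ν s < cdf ν t → s < t := fun h => (cdf ν).mono.reflect_lt h
  have hTm : StrictMono T := fun x y hxy => lt_of (by rw [hT, hT]; exact hΦ hxy)
  refine ⟨T, hTm, hT, ?_⟩
  have hTmeas : Measurable T := hTm.monotone.measurable
  have : IsProbabilityMeasure (μ.map T) := Measure.isProbabilityMeasure_map hTmeas.aemeasurable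
  refine Measure.ext_of_Iic _ _ fun t => ?_
  rw [Measure.map_apply hTmeas measurableSet_Iic, ← ofReal_cdf ν t]
  rcases (cdf_nonneg ν t).eq_or_lt with h0 | h0
  · have : T ⁻¹' Iic t = ∅ := by
      refine eq_empty_of_forall_notMem fun x hx => ?_
      have := (cdf ν).mono (show T x ≤ t from hx)
      rw [hT] at this
      linarith [hpos x]
    rw [this, ← h0]
    simp
  rcases (cdf_le_one ν t).eq_or_lt with h1 | h1
  · have : T ⁻¹' Iic t = univ := by
      refine eq_univ_of_forall fun x => (lt_of ?_).le
      rw [hT, h1]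
      exact hlt x
    rw [this, h1]
    simp
  · obtain ⟨s, hs⟩ := ivt μ _ h0 h1
    rw [← hs, ofReal_cdf]
    refine le_antisymm (measure_mono fun x hx => ?_) ?_
    · have := (cdf ν).mono (show T x ≤ t from hx)
      rw [hT, ← hs] at this
      exact hΦ.le_iff_le.1 this
    · rw [← measure_congr Iio_ae_eq_Iic]
      refine measure_mono fun x hx => (lt_of ?_).le
      rw [hT, ← hs]
      exact hΦ hx

lemma densMeasure_gaussianPDFReal {v : ℝ≥0} (hv : v ≠ 0) :
    densMeasure (gaussianPDFReal 0 v) = gaussianReal 0 v :=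
  (gaussianReal_of_var_ne_zero 0 hv).symm

lemma isDensity_gaussianPDFReal {v : ℝ≥0} (hv : v ≠ 0) : IsDensity (gaussianPDFReal 0 v) :=
  ⟨measurable_gaussianPDFReal 0 v, gaussianPDFReal_nonneg 0 v,
    integral_gaussianPDFReal_eq_one 0 hv⟩

/-- The transport map from the standard Gaussian to a density `f` solves the Monge–Ampère
equation almost everywhere. -/
lemma exists_gaussian_transport {f : ℝ → ℝ} (hf : IsDensity f) :
    ∃ T : ℝ → ℝ, StrictMono T ∧ (gaussianReal 0 1).map T = densMeasure f ∧
      ∀ᵐ x ∂gaussianReal 0 1, DifferentiableAt ℝ T x ∧ 0 < f (T x) ∧ 0 < deriv T x ∧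
        f (T x) * deriv T x = gaussianPDFReal 0 1 x := by
  have h1 : (1 : ℝ≥0) ≠ 0 := one_ne_zero
  have := hf.isProbabilityMeasure
  have : NullSingletonClass (gaussianReal 0 1) := nullSingletonClass_gaussianReal h1
  have : NullSingletonClass (densMeasure f) := by unfold densMeasure; infer_instance
  have : (gaussianReal 0 1).IsOpenPosMeasure :=
    (gaussianReal_absolutelyContinuous' 0 h1).isOpenPosMeasure
  obtain ⟨T, hT, hcdf, hmap⟩ := exists_strictMono_map_eq (gaussianReal 0 1) (densMeasure f)
  refine ⟨T, hT, hmap, ?_⟩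
  have hTmeas : Measurable T := hT.monotone.measurable
  have hF : ∀ᵐ x ∂gaussianReal 0 1,
      HasDerivAt (cdf (densMeasure f)) (f (T x)) (T x) ∧ 0 < f (T x) := by
    refine ae_of_ae_map hTmeas.aemeasurable (p := fun y =>
      HasDerivAt (cdf (densMeasure f)) (f y) y ∧ 0 < f y) ?_
    rw [hmap]
    filter_upwards [(IsDensity.absolutelyContinuous f).ae_le hf.ae_hasDerivAt_cdf, hf.ae_pos]
      with y h1 h2 using ⟨h1, h2⟩
  have hΦ := (isDensity_gaussianPDFReal h1).ae_hasDerivAt_cdf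
  rw [densMeasure_gaussianPDFReal h1] at hΦ
  have hac := (gaussianReal_absolutelyContinuous 0 h1).ae_le
  filter_upwards [hF, hac hΦ, hac hT.monotone.ae_differentiableAt] with x hx hx' hd
  have hchain := hx.1.comp x hd.hasDerivAt
  rw [show cdf (densMeasure f) ∘ T = cdf (gaussianReal 0 1) from funext hcdf] at hchain
  have he := hchain.unique hx'
  have hg := gaussianPDFReal_pos 0 1 x h1
  exact ⟨hd, hx.2, by rw [← he] at hg; exact pos_of_mul_pos_right hg hx.2.le, he⟩

lemma lintegral_gaussian_prod_eq_rotate {F : ℝ × ℝ → ℝ≥0∞} (hF : Measurable F) :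
    ∫⁻ p, F p ∂(gaussianReal 0 1).prod (gaussianReal 0 1) =
      ∫⁻ u, ∫⁻ v, F (√2 / 2 * u + √2 / 2 * v, -(√2 / 2) * u + √2 / 2 * v)
        ∂gaussianReal 0 1 ∂gaussianReal 0 1 := by
  have h := IsGaussian.map_rotation_eq_self_of_forall_strongDual_eq_zero
    (μ := gaussianReal 0 1) (fun L => by simp) (π / 4)
  conv_lhs => rw [← h]
  rw [lintegral_map hF (by fun_prop), lintegral_prod _ (by fun_prop)]
  simp [ContinuousLinearMap.rotation_apply]

/-- Change of variables along the monotone maps `v ↦ T (u + v) + T (v - u)` (up to scaling),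
averaged over a Gaussian `u`. -/
lemma lintegral_transport_sum_le {T : ℝ → ℝ} (hT : StrictMono T) {G : ℝ → ℝ≥0∞}
    (hG : Measurable G) :
    ∫⁻ p, ({x | DifferentiableAt ℝ T x} ×ˢ {x | DifferentiableAt ℝ T x}).indicator
      (fun p : ℝ × ℝ => G (T p.1 + T p.2) * ENNReal.ofReal
        (√2 / 2 * (deriv T p.1 + deriv T p.2) / gaussianPDFReal 0 1 (√2 / 2 * (p.1 + p.2)))) p
      ∂(gaussianReal 0 1).prod (gaussianReal 0 1) ≤ ∫⁻ z, G z := by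
  have hTmeas : Measurable T := hT.monotone.measurable
  have hD : MeasurableSet {x | DifferentiableAt ℝ T x} := measurableSet_of_differentiableAt ℝ T
  have hφ := measurable_gaussianPDFReal 0 1
  have hT' := measurable_deriv T
  have hr : 0 < √2 / 2 := by positivity
  have hr2 : (√2 / 2) * (√2 / 2) = 1 / 2 := by
    have := Real.mul_self_sqrt (show (0 : ℝ) ≤ 2 by norm_num)
    linarith
  set r := √2 / 2 with hrdef
  set F := ({x | DifferentiableAt ℝ T x} ×ˢ {x | DifferentiableAt ℝ T x}).indicator
    (fun p : ℝ × ℝ => G (T p.1 + T p.2) * ENNReal.ofReal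
      (r * (deriv T p.1 + deriv T p.2) / gaussianPDFReal 0 1 (r * (p.1 + p.2)))) with hFdef
  have hF : Measurable F := by
    refine Measurable.indicator ?_ (hD.prod hD)
    fun_prop
  rw [lintegral_gaussian_prod_eq_rotate hF]
  refine (lintegral_mono (g := fun _ => ∫⁻ z, G z) fun u => ?_).trans (by simp)
  have hFu : Measurable fun v => F (r * u + r * v, -r * u + r * v) := hF.comp (by fun_prop)
  rw [gaussianReal_of_var_ne_zero 0 one_ne_zero,
    lintegral_withDensity_eq_lintegral_mul _ (measurable_gaussianPDF 0 1) hFu]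
  set S : Set ℝ := {v | DifferentiableAt ℝ T (r * u + r * v)} ∩
    {v | DifferentiableAt ℝ T (-r * u + r * v)} with hS
  have hSm : MeasurableSet S :=
    ((by fun_prop : Measurable fun v => r * u + r * v) hD).inter
      ((by fun_prop : Measurable fun v => -r * u + r * v) hD)
  set Θ : ℝ → ℝ := fun v => T (r * u + r * v) + T (-r * u + r * v) with hΘ
  have hΘmono : StrictMono Θ := fun v w hvw =>
    add_lt_add (hT (by gcongr)) (hT (by gcongr))
  set Θ' : ℝ → ℝ := fun v =>
    r * (deriv T (r * u + r * v) + deriv T (-r * u + r * v)) with hΘ'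
  have hderiv : ∀ v ∈ S, HasDerivWithinAt Θ (Θ' v) S v := by
    rintro v ⟨h1, h2⟩
    have aux : ∀ c : ℝ, HasDerivAt (fun v => c + r * v) r v := fun c => by
      simpa using ((hasDerivAt_id v).const_mul r).const_add c
    have e1 := HasDerivAt.comp v h1.hasDerivAt (aux (r * u))
    have e2 := HasDerivAt.comp v h2.hasDerivAt (aux (-r * u))
    refine ((e1.add e2).congr_deriv ?_).hasDerivWithinAt
    simp only [hΘ']
    ring
  have hΘ'nn : ∀ v, 0 ≤ Θ' v := fun v =>
    mul_nonneg hr.le (add_nonneg hT.monotone.deriv_nonneg hT.monotone.deriv_nonneg)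
  calc _ = ∫⁻ v in S, ENNReal.ofReal |Θ' v| * G (Θ v) := by
        rw [← lintegral_indicator hSm]
        refine lintegral_congr fun v => ?_
        by_cases hv : v ∈ S
        · have hv' : (r * u + r * v, -r * u + r * v) ∈
              {x | DifferentiableAt ℝ T x} ×ˢ {x | DifferentiableAt ℝ T x} := hv
          rw [indicator_of_mem hv, Pi.mul_apply, hFdef, indicator_of_mem hv',
            show r * (r * u + r * v + (-r * u + r * v)) = v by linear_combination 2 * v * hr2,
            abs_of_nonneg (hΘ'nn v), gaussianPDF, mul_left_comm,
            ← ENNReal.ofReal_mul (gaussianPDFReal_nonneg 0 1 v), mul_comm]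
          congr 2
          rw [mul_div_cancel₀ _ (gaussianPDFReal_pos 0 1 v one_ne_zero).ne']
        · have hv' : (r * u + r * v, -r * u + r * v) ∉
              {x | DifferentiableAt ℝ T x} ×ˢ {x | DifferentiableAt ℝ T x} := hv
          rw [indicator_of_notMem hv, Pi.mul_apply, hFdef, indicator_of_notMem hv',
            mul_zero]
    _ = ∫⁻ z in Θ '' S, G z :=
        (lintegral_image_eq_lintegral_abs_deriv_mul hSm hderiv hΘmono.injective.injOn G).symm
    _ ≤ ∫⁻ z, G z := setLIntegral_le_lintegral _ _

namespace IsDensity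

variable {f : ℝ → ℝ}

lemma map_add_prod (hf : IsDensity f) :
    ((densMeasure f).prod (densMeasure f)).map (fun p => p.1 + p.2) =
      densMeasure (selfConv f) := by
  have := hf.isProbabilityMeasure
  have hm := hf.measurable
  have hconv := conv_withDensity_eq_lconvolution (μ := (volume : Measure ℝ))
    hm.ennreal_ofReal hm.ennreal_ofReal
  have hmap : ((densMeasure f).prod (densMeasure f)).map (fun p => p.1 + p.2) =
      volume.withDensity ((fun x => ENNReal.ofReal (f x)) ⋆ₗ fun x => ENNReal.ofReal (f x)) :=
    hconv
  have hfin : ∀ᵐ z, ((fun x => ENNReal.ofReal (f x)) ⋆ₗ fun x => ENNReal.ofReal (f x)) z < ∞ := by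
    refine ae_lt_top (measurable_lconvolution _ hm.ennreal_ofReal hm.ennreal_ofReal) ?_
    have hp : IsProbabilityMeasure
        (((densMeasure f).prod (densMeasure f)).map (fun p => p.1 + p.2)) :=
      Measure.isProbabilityMeasure_map (by fun_prop)
    rw [hmap] at hp
    have h1 := hp.measure_univ
    rw [withDensity_apply _ MeasurableSet.univ, Measure.restrict_univ] at h1
    simp [h1]
  rw [hmap, densMeasure]
  refine withDensity_congr_ae ?_
  filter_upwards [hfin] with z hz
  have he : ((fun x => ENNReal.ofReal (f x)) ⋆ₗ fun x => ENNReal.ofReal (f x)) z =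
      ∫⁻ x, ENNReal.ofReal (f x * f (z - x)) := by
    rw [lconvolution_def]
    refine lintegral_congr fun x => ?_
    rw [ENNReal.ofReal_mul (hf.nonneg x), neg_add_eq_sub]
  rw [he] at hz ⊢
  rw [selfConv, integral_eq_lintegral_of_nonneg_ae
    (ae_of_all _ fun x => mul_nonneg (hf.nonneg _) (hf.nonneg _))
    (by fun_prop), ENNReal.ofReal_toReal hz.ne]

lemma isDensity_selfConv (hf : IsDensity f) : IsDensity (selfConv f) := by
  have := hf.isProbabilityMeasure
  have hm := hf.measurable
  have hmeas : Measurable (selfConv f) :=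
    (StronglyMeasurable.integral_prod_right (f := fun z x => f x * f (z - x)) (by
      fun_prop : Measurable fun p : ℝ × ℝ => f p.2 * f (p.1 - p.2)).stronglyMeasurable).measurable
  have hnn : ∀ z, 0 ≤ selfConv f z := fun z =>
    integral_nonneg fun x => mul_nonneg (hf.nonneg _) (hf.nonneg _)
  refine ⟨hmeas, hnn, ?_⟩
  have hp : IsProbabilityMeasure
      (((densMeasure f).prod (densMeasure f)).map (fun p => p.1 + p.2)) :=
    Measure.isProbabilityMeasure_map (by fun_prop)
  rw [hf.map_add_prod] at hp
  have h1 := hp.measure_univ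
  rw [densMeasure, withDensity_apply _ MeasurableSet.univ, Measure.restrict_univ] at h1
  rw [integral_eq_lintegral_of_nonneg_ae (ae_of_all _ hnn) hmeas.aestronglyMeasurable, h1,
    ENNReal.toReal_one]

end IsDensity

lemma selfConv_eq_zero {f : ℝ → ℝ} {a : ℝ} (hf : ∀ x ∉ Ioo (-a) a, f x = 0) {z : ℝ}
    (hz : z ∉ Icc (-(2 * a)) (2 * a)) : selfConv f z = 0 := by
  refine integral_eq_zero_of_ae (ae_of_all _ fun x => ?_)
  by_cases hx : x ∈ Ioo (-a) a
  · have : z - x ∉ Ioo (-a) a := fun h => hz ⟨by linarith [hx.1, h.1], by linarith [hx.2, h.2]⟩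
    simp [hf _ this]
  · simp [hf _ hx]

lemma IsDensity.integrable_min_log {g : ℝ → ℝ} (hg : IsDensity g) {b : ℝ}
    (hsupp : ∀ z ∉ Icc (-b) b, g z = 0) :
    Integrable (fun z => min (Real.log (g z)) 0) (densMeasure g) := by
  rw [hg.integrable_densMeasure]
  have hm := hg.measurable
  refine Integrable.mono' (g := (Icc (-b) b).indicator fun _ => (1 : ℝ))
    ((integrable_indicator_iff measurableSet_Icc).2 (by simp)) (by fun_prop)
    (ae_of_all _ fun z => ?_)
  by_cases hz : z ∈ Icc (-b) b
  · rw [indicator_of_mem hz, Real.norm_eq_abs]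
    rcases (hg.nonneg z).eq_or_lt with h0 | h0
    · simp [← h0]
    rcases le_total (g z) 1 with h1 | h1
    · rw [min_eq_left (Real.log_nonpos h0.le h1), mul_comm]
      exact (Real.abs_log_mul_self_lt _ h0 h1).le
    · simp [min_eq_right (Real.log_nonneg h1)]
  · simp [hsupp z hz, indicator_of_notMem hz]

lemma log_gaussianPDFReal {v : ℝ≥0} (hv : v ≠ 0) (x : ℝ) :
    Real.log (gaussianPDFReal 0 v x) = -(Real.log (2 * π * v) / 2) - x ^ 2 / (2 * v) := by
  have hv' : (0 : ℝ) < v := by positivity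
  rw [gaussianPDFReal, Real.log_mul (by positivity) (by positivity), Real.log_inv,
    Real.log_sqrt (by positivity), Real.log_exp]
  ring

lemma log_le_of_transport {x y A B a b G : ℝ} (hA : 0 < A) (hB : 0 < B) (ha : 0 < a) (hb : 0 < b)
    (hG : 0 < G) (hx : A * a = gaussianPDFReal 0 1 x) (hy : B * b = gaussianPDFReal 0 1 y) :
    Real.log G ≤ G * (√2 / 2 * (a + b) / gaussianPDFReal 0 1 (√2 / 2 * (x + y))) - 1
      - 2⁻¹ * (x * y) - 2⁻¹ * Real.log 2 + 2⁻¹ * Real.log A + 2⁻¹ * Real.log B := by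
  have h1 : (1 : ℝ≥0) ≠ 0 := one_ne_zero
  have hφ := gaussianPDFReal_pos 0 1 (√2 / 2 * (x + y)) h1
  have hr : 0 < √2 / 2 := by positivity
  have hs : √2 * √2 = 2 := Real.mul_self_sqrt (by norm_num)
  have ht := Real.log_le_sub_one_of_pos
    (show 0 < G * (√2 / 2 * (a + b) / gaussianPDFReal 0 1 (√2 / 2 * (x + y))) by positivity)
  rw [Real.log_mul hG.ne' (by positivity), Real.log_div (by positivity) hφ.ne',
    log_gaussianPDFReal h1] at ht
  have hlx := congrArg Real.log hx
  have hly := congrArg Real.log hy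
  rw [Real.log_mul hA.ne' ha.ne', log_gaussianPDFReal h1] at hlx
  rw [Real.log_mul hB.ne' hb.ne', log_gaussianPDFReal h1] at hly
  have hamgm : Real.log (2 * (a * b)) ≤ Real.log ((√2 / 2 * (a + b)) ^ 2) := by
    refine Real.log_le_log (by positivity) ?_
    have : (√2 / 2 * (a + b)) ^ 2 = (a + b) ^ 2 / 2 := by linear_combination (a + b) ^ 2 / 4 * hs
    rw [this]
    nlinarith [sq_nonneg (a - b)]
  rw [Real.log_mul (by norm_num) (by positivity), Real.log_mul ha.ne' hb.ne', Real.log_pow] at hamgm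
  have hsq : (√2 / 2 * (x + y)) ^ 2 = (x + y) ^ 2 / 2 := by
    linear_combination (x + y) ^ 2 / 4 * hs
  rw [hsq] at ht
  push_cast at *
  linarith

/-- The entropy power inequality for two independent copies of a compactly supported density,
together with finiteness of the entropy of the sum. -/
lemma integrable_and_integral_selfConv_mul_log_le {f : ℝ → ℝ} (hf : IsDensity f) {a : ℝ}
    (hsupp : ∀ x ∉ Ioo (-a) a, f x = 0) (hlog : Integrable fun x => f x * Real.log (f x)) :
    Integrable (fun z => selfConv f z * Real.log (selfConv f z)) ∧
      ∫ z, selfConv f z * Real.log (selfConv f z) ≤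
        (∫ x, f x * Real.log (f x)) - 2⁻¹ * Real.log 2 := by
  obtain ⟨T, hT, hmap, hae⟩ := exists_gaussian_transport hf
  have := hf.isProbabilityMeasure
  have hTm : Measurable T := hT.monotone.measurable
  have hT' := measurable_deriv T
  have hφ := measurable_gaussianPDFReal 0 1
  have hfm := hf.measurable
  have hg := hf.isDensity_selfConv
  set g := selfConv f with hgdef
  have hgm := hg.measurable
  have hlfm : Measurable fun x => Real.log (f x) := by fun_prop
  have hlgm : Measurable fun z => Real.log (g z) := by fun_prop
  set γ := gaussianReal 0 1 with hγ
  set S : ℝ × ℝ → ℝ := fun p => T p.1 + T p.2 with hS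
  have hSm : Measurable S := by fun_prop
  have hmapS : (γ.prod γ).map S = densMeasure g := by
    rw [← hf.map_add_prod, ← hmap, Measure.map_prod_map _ _ hTm hTm,
      Measure.map_map (by fun_prop) (by fun_prop)]
    rfl
  -- the Jensen term
  set J : ℝ × ℝ → ℝ := fun p => g (S p) *
    (√2 / 2 * (deriv T p.1 + deriv T p.2) / gaussianPDFReal 0 1 (√2 / 2 * (p.1 + p.2))) with hJ
  have hJm : Measurable J := by fun_prop
  have hJnn : ∀ p, 0 ≤ J p := fun p => mul_nonneg (hg.nonneg _) (div_nonneg (mul_nonneg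
    (by positivity) (add_nonneg hT.monotone.deriv_nonneg hT.monotone.deriv_nonneg))
    (gaussianPDFReal_nonneg _ _ _))
  have hae1 := Measure.quasiMeasurePreserving_fst (μ := γ) (ν := γ) |>.ae hae
  have hae2 := Measure.quasiMeasurePreserving_snd (μ := γ) (ν := γ) |>.ae hae
  have hJle : ∫⁻ p, ENNReal.ofReal (J p) ∂γ.prod γ ≤ 1 := by
    rw [← hg.lintegral_eq_one]
    refine le_trans (lintegral_mono_ae ?_) (lintegral_transport_sum_le hT hgm.ennreal_ofReal)
    filter_upwards [hae1, hae2] with p h1 h2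
    rw [indicator_of_mem (show p ∈ _ ×ˢ _ from ⟨h1.1, h2.1⟩),
      ← ENNReal.ofReal_mul (hg.nonneg _)]
  have hJint : Integrable J (γ.prod γ) :=
    ⟨hJm.aestronglyMeasurable, by
      rw [hasFiniteIntegral_iff_ofReal (ae_of_all _ hJnn)]
      exact hJle.trans_lt ENNReal.one_lt_top⟩
  have hJ1 : ∫ p, J p ∂γ.prod γ ≤ 1 := by
    rw [integral_eq_lintegral_of_nonneg_ae (ae_of_all _ hJnn) hJm.aestronglyMeasurable]
    exact ENNReal.toReal_le_of_le_ofReal zero_le_one (by simpa using hJle)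
  -- the entropy terms
  have hlogf : Integrable (fun x => Real.log (f x)) (γ.map T) := by
    rw [hmap, hf.integrable_densMeasure]
    exact hlog
  have hlogT : Integrable (fun x => Real.log (f (T x))) γ :=
    (integrable_map_measure hlfm.aestronglyMeasurable hTm.aemeasurable).1 hlogf
  have hlogT_int : ∫ x, Real.log (f (T x)) ∂γ = ∫ x, f x * Real.log (f x) := by
    rw [← hf.integral_densMeasure, ← hmap, integral_map hTm.aemeasurable hlfm.aestronglyMeasurable]
  have hI1 : Integrable (fun p : ℝ × ℝ => Real.log (f (T p.1))) (γ.prod γ) := hlogT.comp_fst γ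
  have hI2 : Integrable (fun p : ℝ × ℝ => Real.log (f (T p.2))) (γ.prod γ) := hlogT.comp_snd γ
  have hid : Integrable (fun x : ℝ => x) γ :=
    (memLp_id_gaussianReal' 1 (by simp)).integrable le_rfl
  have hxy : Integrable (fun p : ℝ × ℝ => p.1 * p.2) (γ.prod γ) := hid.mul_prod hid
  have hxy0 : ∫ p : ℝ × ℝ, p.1 * p.2 ∂γ.prod γ = 0 := by
    rw [integral_prod_mul (fun x : ℝ => x) (fun y : ℝ => y)]
    simp [hγ]
  have e1 : ∫ p : ℝ × ℝ, Real.log (f (T p.1)) ∂γ.prod γ = ∫ x, f x * Real.log (f x) := by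
    rw [integral_fun_fst (μ := γ) (ν := γ) (fun x => Real.log (f (T x))), hlogT_int]
    simp
  have e2 : ∫ p : ℝ × ℝ, Real.log (f (T p.2)) ∂γ.prod γ = ∫ x, f x * Real.log (f x) := by
    rw [integral_fun_snd (μ := γ) (ν := γ) (fun x => Real.log (f (T x))), hlogT_int]
    simp
  set U : ℝ × ℝ → ℝ := fun p => J p - 1 - 2⁻¹ * (p.1 * p.2) - 2⁻¹ * Real.log 2
    + 2⁻¹ * Real.log (f (T p.1)) + 2⁻¹ * Real.log (f (T p.2)) with hU
  have i1 : Integrable (fun p => J p - 1) (γ.prod γ) := hJint.sub (integrable_const _)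
  have i2 : Integrable (fun p => J p - 1 - 2⁻¹ * (p.1 * p.2)) (γ.prod γ) :=
    i1.sub (hxy.const_mul _)
  have i3 : Integrable (fun p => J p - 1 - 2⁻¹ * (p.1 * p.2) - 2⁻¹ * Real.log 2) (γ.prod γ) :=
    i2.sub (integrable_const _)
  have i4 : Integrable (fun p => J p - 1 - 2⁻¹ * (p.1 * p.2) - 2⁻¹ * Real.log 2
    + 2⁻¹ * Real.log (f (T p.1))) (γ.prod γ) := i3.add (hI1.const_mul _)
  have hUint : Integrable U (γ.prod γ) := i4.add (hI2.const_mul _)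
  have hUle : ∫ p, U p ∂γ.prod γ ≤ (∫ x, f x * Real.log (f x)) - 2⁻¹ * Real.log 2 := by
    simp only [hU]
    rw [integral_add i4 (hI2.const_mul _), integral_add i3 (hI1.const_mul _),
      integral_sub i2 (integrable_const _), integral_sub i1 (hxy.const_mul _),
      integral_sub hJint (integrable_const _), integral_const_mul, integral_const_mul,
      integral_const_mul, integral_const_mul, hxy0, e1, e2]
    simp only [integral_const, probReal_univ, smul_eq_mul]
    linarith
  have hLU : ∀ᵐ p ∂γ.prod γ, Real.log (g (S p)) ≤ U p := by
    have hpos : ∀ᵐ p ∂γ.prod γ, 0 < g (S p) := by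
      refine ae_of_ae_map hSm.aemeasurable (p := fun z => 0 < g z) ?_
      rw [hmapS]
      exact hg.ae_pos
    filter_upwards [hae1, hae2, hpos] with p h1 h2 h3
    exact log_le_of_transport h1.2.1 h2.2.1 h1.2.2.1 h2.2.2.1 h3 h1.2.2.2 h2.2.2.2
  have hmin : Integrable (fun p => min (Real.log (g (S p))) 0) (γ.prod γ) := by
    have h := hg.integrable_min_log fun z hz => selfConv_eq_zero hsupp hz
    rw [← hmapS] at h
    exact (integrable_map_measure (hlgm.min measurable_const).aestronglyMeasurable hSm.aemeasurable).1 h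
  have hL : Integrable (fun p => Real.log (g (S p))) (γ.prod γ) := by
    refine Integrable.mono' (hUint.abs.add hmin.abs) (hlgm.comp hSm).aestronglyMeasurable ?_
    filter_upwards [hLU] with p hp
    rw [Real.norm_eq_abs, Pi.add_apply]
    rcases le_total 0 (Real.log (g (S p))) with h | h
    · rw [abs_of_nonneg h]
      linarith [le_abs_self (U p), abs_nonneg (min (Real.log (g (S p))) 0)]
    · rw [min_eq_left h]
      linarith [abs_nonneg (U p)]
  have hLmap : Integrable (fun z => Real.log (g z)) (densMeasure g) := by
    rw [← hmapS]
    exact (integrable_map_measure hlgm.aestronglyMeasurable hSm.aemeasurable).2 hL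
  refine ⟨hg.integrable_densMeasure.1 hLmap, ?_⟩
  rw [← hg.integral_densMeasure, ← hmapS, integral_map hSm.aemeasurable hlgm.aestronglyMeasurable]
  exact (integral_mono_ae hL hUint hLU).trans hUle

/-- Gibbs' inequality. -/
lemma integral_mul_log_le_integral_mul_log {g q : ℝ → ℝ} (hg : IsDensity g) (hq : IsDensity q)
    (hqpos : ∀ x, 0 < q x) (hgg : Integrable fun x => g x * Real.log (g x))
    (hgq : Integrable fun x => g x * Real.log (q x)) :
    ∫ x, g x * Real.log (q x) ≤ ∫ x, g x * Real.log (g x) := by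
  have h : ∫ x, (g x * Real.log (q x) - g x * Real.log (g x)) ≤ ∫ x, (q x - g x) := by
    refine integral_mono (hgq.sub hgg) (hq.integrable.sub hg.integrable) fun x => ?_
    rcases (hg.nonneg x).eq_or_lt with h0 | h0
    · simpa [← h0] using (hqpos x).le
    · have := Real.log_le_sub_one_of_pos (div_pos (hqpos x) h0)
      rw [Real.log_div (hqpos x).ne' h0.ne'] at this
      have h2 := mul_le_mul_of_nonneg_left this h0.le
      have h3 : g x * (q x / g x - 1) = q x - g x := by field_simp
      simp only
      linarith
  rw [integral_sub hgq hgg, integral_sub hq.integrable hg.integrable, hg.integral_eq_one,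
    hq.integral_eq_one] at h
  linarith

lemma IsDensity.integrable_sq_mul {f : ℝ → ℝ} (hf : IsDensity f) {b : ℝ}
    (hsupp : ∀ x ∉ Icc (-b) b, f x = 0) : Integrable fun x => f x * x ^ 2 := by
  have hm := hf.measurable
  refine Integrable.mono' (hf.integrable.mul_const (b ^ 2)) (by fun_prop) (ae_of_all _ fun x => ?_)
  rw [Real.norm_eq_abs, abs_of_nonneg (mul_nonneg (hf.nonneg x) (sq_nonneg x))]
  by_cases hx : x ∈ Icc (-b) b
  · exact mul_le_mul_of_nonneg_left (sq_le_sq' hx.1 hx.2) (hf.nonneg x)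
  · simp [hsupp x hx]

/-- The second moment of the sum of two independent copies of a centered variable. -/
lemma IsDensity.integral_selfConv_mul_sq {f : ℝ → ℝ} (hf : IsDensity f)
    (hsq : Integrable fun x => f x * x ^ 2) (heven : ∀ x, f (-x) = f x) :
    ∫ z, selfConv f z * z ^ 2 = 2 * ∫ x, f x * x ^ 2 := by
  have := hf.isProbabilityMeasure
  set μ := densMeasure f with hμ
  have hsq' : Integrable (fun x => x ^ 2) μ := hf.integrable_densMeasure.2 hsq
  have hid : Integrable (fun x : ℝ => x) μ :=
    ((memLp_two_iff_integrable_sq (by fun_prop)).2 hsq').integrable one_le_two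
  have h0 : ∫ x, x ∂μ = 0 := by
    rw [hf.integral_densMeasure]
    have h := integral_neg_eq_self (fun x => f x * x) volume
    simp only [heven, mul_neg, integral_neg] at h
    linarith
  have i1 : Integrable (fun p : ℝ × ℝ => p.1 ^ 2) (μ.prod μ) := hsq'.comp_fst μ
  have i2 : Integrable (fun p : ℝ × ℝ => p.2 ^ 2) (μ.prod μ) := hsq'.comp_snd μ
  have i3 : Integrable (fun p : ℝ × ℝ => 2 * (p.1 * p.2)) (μ.prod μ) :=
    (hid.mul_prod hid).const_mul 2
  rw [← hf.isDensity_selfConv.integral_densMeasure (fun z => z ^ 2), ← hf.map_add_prod,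
    integral_map (by fun_prop) (by fun_prop)]
  have i4 : Integrable (fun p : ℝ × ℝ => p.1 ^ 2 + 2 * (p.1 * p.2)) (μ.prod μ) := i1.add i3
  have hexp : ∀ p : ℝ × ℝ, (p.1 + p.2) ^ 2 = p.1 ^ 2 + 2 * (p.1 * p.2) + p.2 ^ 2 := fun p => by
    ring
  simp only [hexp]
  rw [← hμ, integral_add i4 i2, integral_add i1 i3, integral_const_mul,
    integral_prod_mul (fun x : ℝ => x) (fun y : ℝ => y), h0,
    integral_fun_fst (μ := μ) (ν := μ) (fun x => x ^ 2),
    integral_fun_snd (μ := μ) (ν := μ) (fun x => x ^ 2), hf.integral_densMeasure]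
  simp
  ring

lemma entRatio_eq_exp (p : ℝ → ℝ) :
    entRatio p = Real.exp (2 * entOfDensity p - 2 * entOfDensity (selfConv p)) :=
  (Real.exp_sub _ _).symm

lemma isDensity_of_mem_Lam {α : ℝ} {p : ℝ → ℝ} (hp : p ∈ Lam α) : IsDensity p :=
  ⟨hp.1, hp.2.1, hp.2.2.2.1⟩

lemma entRatio_le_half {α : ℝ} {p : ℝ → ℝ} (hp : p ∈ Lam α) : entRatio p ≤ 1 / 2 := by
  have h := (integrable_and_integral_selfConv_mul_log_le (isDensity_of_mem_Lam hp)
    hp.2.2.1 hp.2.2.2.2).2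
  rw [entRatio_eq_exp, ← Real.le_log_iff_exp_le (by norm_num), one_div, Real.log_inv,
    entOfDensity, entOfDensity]
  linarith

lemma one_sub_le_gaussianReal_real_Ioo (v : ℝ≥0) {a : ℝ} (ha : 0 < a) :
    1 - v / a ^ 2 ≤ (gaussianReal 0 v).real (Ioo (-a) a) := by
  have h := meas_ge_le_variance_div_sq (μ := gaussianReal 0 v) (X := id)
    (memLp_id_gaussianReal 2) ha
  simp only [id, integral_id_gaussianReal, sub_zero, variance_id_gaussianReal] at h
  have hc : {x : ℝ | a ≤ |x|} = (Ioo (-a) a)ᶜ := by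
    ext x
    simp [← abs_lt]
  rw [hc] at h
  have h2 := ENNReal.toReal_le_of_le_ofReal (by positivity) h
  rw [← measureReal_def, probReal_compl_eq_one_sub measurableSet_Ioo] at h2
  linarith

/-- Truncated centered Gaussians of variance parameter `v` have ratio at least `m ^ 2 / 2`, where
`m` is the mass of the Gaussian on the truncation interval. -/
lemma exists_mem_Lam_sq_half_le_entRatio {α : ℝ} (hα : 0 < α) {v : ℝ≥0} (hv : v ≠ 0) :
    ∃ p ∈ Lam α, (gaussianReal 0 v).real (Ioo (-(α / 4)) (α / 4)) ^ 2 / 2 ≤ entRatio p := by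
  have hv' : (0 : ℝ) < v := by positivity
  set a := α / 4 with ha
  have ha0 : 0 < a := by positivity
  set m := (gaussianReal 0 v).real (Ioo (-a) a) with hm
  have hφ := isDensity_gaussianPDFReal hv
  have hφm := hφ.measurable
  have : (gaussianReal 0 v).IsOpenPosMeasure :=
    (gaussianReal_absolutelyContinuous' 0 hv).isOpenPosMeasure
  have hm0 : 0 < m := ENNReal.toReal_pos
    ((Measure.measure_Ioo_pos _).2 (by linarith)).ne' (measure_ne_top _ _)
  set p : ℝ → ℝ := (Ioo (-a) a).indicator fun x => m⁻¹ * gaussianPDFReal 0 v x with hp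
  have hpd : IsDensity p := by
    refine ⟨Measurable.indicator (by fun_prop) measurableSet_Ioo, fun x => indicator_nonneg (fun x _ =>
      mul_nonneg (by positivity) (hφ.nonneg x)) x, ?_⟩
    rw [integral_indicator measurableSet_Ioo, integral_const_mul, hm, measureReal_def,
      gaussianReal_apply_eq_integral 0 hv, ENNReal.toReal_ofReal
      (integral_nonneg hφ.nonneg), inv_mul_cancel₀]
    intro h0
    rw [measureReal_def, gaussianReal_apply_eq_integral 0 hv, h0] at hm
    simp [hm] at hm0
  have hsupp : ∀ x ∉ Ioo (-a) a, p x = 0 := fun x hx => indicator_of_notMem hx _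
  have hsq := hpd.integrable_sq_mul (b := a) fun x hx =>
    hsupp x fun h => hx (Ioo_subset_Icc_self h)
  have heven : ∀ x, p (-x) = p x := by
    intro x
    by_cases hx : x ∈ Ioo (-a) a
    · have hx' : -x ∈ Ioo (-a) a := ⟨by linarith [hx.2], by linarith [hx.1]⟩
      simp [hp, indicator_of_mem hx, indicator_of_mem hx', gaussianPDFReal]
    · have hx' : -x ∉ Ioo (-a) a := fun h => hx ⟨by linarith [h.2], by linarith [h.1]⟩
      rw [hsupp _ hx, hsupp _ hx']
  have hlogp : ∀ x, p x * Real.log (p x) =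
      (-Real.log m - Real.log (2 * π * v) / 2) * p x - (2 * v : ℝ)⁻¹ * (p x * x ^ 2) := by
    intro x
    by_cases hx : x ∈ Ioo (-a) a
    · have : Real.log (p x) = -Real.log m + (-(Real.log (2 * π * v) / 2) - x ^ 2 / (2 * v)) := by
        rw [hp, indicator_of_mem hx, Real.log_mul (by positivity)
          (gaussianPDFReal_pos 0 v x hv).ne', Real.log_inv, log_gaussianPDFReal hv]
      rw [this]
      ring
    · simp [hsupp x hx]
  have hpint : Integrable fun x => p x * Real.log (p x) := by
    simp only [hlogp]
    exact (hpd.integrable.const_mul _).sub (hsq.const_mul _)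
  have hent : ∫ x, p x * Real.log (p x) =
      -Real.log m - Real.log (2 * π * v) / 2 - (2 * v : ℝ)⁻¹ * ∫ x, p x * x ^ 2 := by
    simp only [hlogp]
    rw [integral_sub (hpd.integrable.const_mul _) (hsq.const_mul _), integral_const_mul,
      integral_const_mul, hpd.integral_eq_one, mul_one]
  have hg := hpd.isDensity_selfConv
  have hgint := (integrable_and_integral_selfConv_mul_log_le hpd hsupp hpint).1
  have hgsq := hg.integrable_sq_mul fun z hz => selfConv_eq_zero hsupp hz
  have h2v : 2 * v ≠ 0 := mul_ne_zero two_ne_zero hv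
  have hlogq : ∀ z, selfConv p z * Real.log (gaussianPDFReal 0 (2 * v) z) =
      (-(Real.log (2 * (2 * π * v)) / 2)) * selfConv p z
        - (4 * v : ℝ)⁻¹ * (selfConv p z * z ^ 2) := by
    intro z
    rw [log_gaussianPDFReal h2v]
    push_cast
    rw [show 2 * π * (2 * v) = 2 * (2 * π * (v : ℝ)) by ring]
    field_simp
    ring
  have hqint : Integrable fun z => selfConv p z * Real.log (gaussianPDFReal 0 (2 * v) z) := by
    simp only [hlogq]
    exact (hg.integrable.const_mul _).sub (hgsq.const_mul _)
  have hgibbs := integral_mul_log_le_integral_mul_log hg (isDensity_gaussianPDFReal h2v)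
    (fun x => gaussianPDFReal_pos 0 _ x h2v) hgint hqint
  simp only [hlogq] at hgibbs
  rw [integral_sub (hg.integrable.const_mul _) (hgsq.const_mul _), integral_const_mul,
    integral_const_mul, hg.integral_eq_one, mul_one, hpd.integral_selfConv_mul_sq hsq heven,
    Real.log_mul two_ne_zero (by positivity)] at hgibbs
  refine ⟨p, ⟨hpd.measurable, hpd.nonneg, hsupp, hpd.integral_eq_one, hpint⟩, ?_⟩
  rw [entRatio_eq_exp, ← Real.log_le_iff_le_exp (by positivity),
    Real.log_div (by positivity) two_ne_zero, Real.log_pow, entOfDensity, entOfDensity, hent]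
  have hM : (4 * v : ℝ)⁻¹ * (2 * ∫ x, p x * x ^ 2) = (2 * v : ℝ)⁻¹ * ∫ x, p x * x ^ 2 := by
    field_simp
    ring
  rw [hM] at hgibbs
  push_cast
  linarith

/-- For any `α > 0`,
`sup_{p ∈ Λ} exp (2 h(W₁)) / exp (2 h(W₁ + W₂)) = 1/2`, where for each `p ∈ Λ` the
random variables `W₁`, `W₂` are independent with common density `p`. -/
theorem sup_entRatio_eq_half (α : ℝ) (hα : 0 < α) :
    sSup (entRatio '' Lam α) = 1 / 2 := by
  refine csSup_eq_of_forall_le_of_forall_lt_exists_gt ?_ ?_ fun w hw => ?_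
  · obtain ⟨p, hp, -⟩ := exists_mem_Lam_sq_half_le_entRatio hα one_ne_zero
    exact ⟨_, p, hp, rfl⟩
  · rintro _ ⟨p, hp, rfl⟩
    exact entRatio_le_half hp
  · have ha : 0 < α / 4 := by positivity
    have hδ : 0 < (1 - 2 * w) / 4 * (α / 4) ^ 2 := mul_pos (by linarith) (by positivity)
    obtain ⟨p, hp, hle⟩ := exists_mem_Lam_sq_half_le_entRatio hα (Real.toNNReal_pos.2 hδ).ne'
    refine ⟨_, ⟨p, hp, rfl⟩, lt_of_lt_of_le ?_ hle⟩
    have hm := one_sub_le_gaussianReal_real_Ioo ((1 - 2 * w) / 4 * (α / 4) ^ 2).toNNReal ha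
    rw [Real.coe_toNNReal _ hδ.le, mul_div_cancel_right₀ _ (by positivity)] at hm
    nlinarith [sq_nonneg ((gaussianReal 0 ((1 - 2 * w) / 4 * (α / 4) ^ 2).toNNReal).real
      (Ioo (-(α / 4)) (α / 4)) - 1)]
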